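/- arXiv:2103.07628 — 8 statements merged into one kernel-verified Lean document; each statement's English description precedes it below -/
import Mathlib

section
/- Let Ω = (a,b)×(c,d) with a < b and c < d. If v : ℝ² → ℝ is three times continuously differentiable and vanishes on ∂Ω, then (∫_Ω (Δv)² )^{1/2} ≤ (d−c)·(∫_Ω (v_xxy)² )^{1/2} + (b−a)·(∫_Ω (v_xyy)² )^{1/2}. -/
open MeasureTheory Set

/-- Partial derivative with respect to the first variable. -/
noncomputable def pdx (v : ℝ × ℝ → ℝ) : ℝ × ℝ → ℝ :=
  fun p => deriv (fun x => v (x, p.2)) p.1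

/-- Partial derivative with respect to the second variable. -/
noncomputable def pdy (v : ℝ × ℝ → ℝ) : ℝ × ℝ → ℝ :=
  fun p => deriv (fun y => v (p.1, y)) p.2

theorem aux_cs {α : Type*} [MeasurableSpace α] (μ : Measure α) (F H : α → ℝ)
    (h1 : Integrable (fun x => F x ^ 2) μ) (h2 : Integrable (fun x => F x * H x) μ)
    (h3 : Integrable (fun x => H x ^ 2) μ) :
    (∫ x, F x * H x ∂μ) ^ 2 ≤ (∫ x, F x ^ 2 ∂μ) * (∫ x, H x ^ 2 ∂μ) := by
  have key : ∀ t : ℝ, 0 ≤ (∫ x, F x ^ 2 ∂μ) * (t * t) + (2 * ∫ x, F x * H x ∂μ) * t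
      + ∫ x, H x ^ 2 ∂μ := by
    intro t
    have h0 : 0 ≤ ∫ x, (F x * t + H x) ^ 2 ∂μ := integral_nonneg fun x => sq_nonneg _
    have e : (fun x => (F x * t + H x) ^ 2)
        = fun x => (t * t) * F x ^ 2 + (2 * t) * (F x * H x) + H x ^ 2 := by
      funext x; ring
    have i12 : Integrable (fun x => (t * t) * F x ^ 2 + (2 * t) * (F x * H x)) μ :=
      (h1.const_mul _).add (h2.const_mul _)
    rw [e, integral_add i12 h3,
      integral_add (h1.const_mul _) (h2.const_mul _), integral_const_mul, integral_const_mul] at h0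
    linarith
  have := discrim_le_zero key
  unfold discrim at this
  nlinarith

theorem aux_mink {α : Type*} [MeasurableSpace α] (μ : Measure α) (F H : α → ℝ)
    (h1 : Integrable (fun x => F x ^ 2) μ) (h2 : Integrable (fun x => F x * H x) μ)
    (h3 : Integrable (fun x => H x ^ 2) μ) :
    √(∫ x, (F x + H x) ^ 2 ∂μ) ≤ √(∫ x, F x ^ 2 ∂μ) + √(∫ x, H x ^ 2 ∂μ) := by
  have cs := aux_cs μ F H h1 h2 h3
  have e : (fun x => (F x + H x) ^ 2)
        = fun x => F x ^ 2 + 2 * (F x * H x) + H x ^ 2 := by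
      funext x; ring
  have hF : 0 ≤ ∫ x, F x ^ 2 ∂μ := integral_nonneg fun x => sq_nonneg _
  have hH : 0 ≤ ∫ x, H x ^ 2 ∂μ := integral_nonneg fun x => sq_nonneg _
  have i12 : Integrable (fun x => F x ^ 2 + 2 * (F x * H x)) μ := h1.add (h2.const_mul _)
  rw [e, integral_add i12 h3, integral_add h1 (h2.const_mul _),
    integral_const_mul]
  apply Real.sqrt_le_iff.2
  refine ⟨by positivity, ?_⟩
  rw [add_sq, Real.sq_sqrt hF, Real.sq_sqrt hH]
  have : ∫ x, F x * H x ∂μ ≤ √(∫ x, F x ^ 2 ∂μ) * √(∫ x, H x ^ 2 ∂μ) := by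
    rw [← Real.sqrt_mul hF]
    exact Real.le_sqrt_of_sq_le cs
  linarith

theorem aux_1d (c d : ℝ) (hcd : c < d) (f g : ℝ → ℝ) (hg : Continuous g)
    (hf : ∀ y, HasDerivAt f (g y) y) (h0 : f c = 0) :
    ∫ y in Ioo c d, f y ^ 2 ≤ (d - c) ^ 2 * ∫ y in Ioo c d, g y ^ 2 := by
  have hint : ∀ h : ℝ → ℝ, Continuous h → ∀ y, IntegrableOn h (Ioo c y) := fun h hh y =>
    (hh.integrableOn_Icc (a := c) (b := y)).mono_set Ioo_subset_Icc_self
  have hfc : Continuous f := continuous_iff_continuousAt.2 fun y => (hf y).continuousAt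
  have hpt : ∀ y ∈ Ioo c d, f y ^ 2 ≤ (d - c) * ∫ y in Ioo c d, g y ^ 2 := by
    intro y hy
    have e : f y = ∫ t in Ioo c y, g t * 1 := by
      have := intervalIntegral.integral_eq_sub_of_hasDerivAt (a := c) (b := y)
        (fun t _ => hf t) (hg.intervalIntegrable _ _)
      rw [h0, intervalIntegral.integral_of_le hy.1.le, integral_Ioc_eq_integral_Ioo] at this
      simp [this]
    have cs := aux_cs (volume.restrict (Ioo c y)) g (fun _ => 1) (hint _ (by fun_prop) y)
      (hint _ (by fun_prop) y) (hint _ (by fun_prop) y)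
    have e1 : ∫ x in Ioo c y, (1:ℝ) ^ 2 = y - c := by
      simp [hy.1.le]
    rw [← e, e1] at cs
    have hm : ∫ t in Ioo c y, g t ^ 2 ≤ ∫ t in Ioo c d, g t ^ 2 :=
      setIntegral_mono_set (hint _ (by fun_prop) d) (ae_of_all _ fun _ => sq_nonneg _)
        (Ioo_subset_Ioo_right hy.2.le).eventuallyLE
    have hp : 0 ≤ ∫ t in Ioo c y, g t ^ 2 := integral_nonneg fun x => sq_nonneg _
    have := hy.1
    have := hy.2
    calc _ ≤ _ := cs
      _ ≤ (∫ t in Ioo c d, g t ^ 2) * (d - c) := by gcongr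
      _ = _ := by ring
  calc _ ≤ ∫ y in Ioo c d, ((d - c) * ∫ y in Ioo c d, g y ^ 2) :=
        setIntegral_mono_on (hint _ (by fun_prop) d) (hint _ (by fun_prop) d) measurableSet_Ioo hpt
    _ = _ := by
      simp [hcd.le]; ring

theorem aux_int (a b c d : ℝ) (F : ℝ × ℝ → ℝ) (hF : Continuous F) :
    IntegrableOn F (Ioo a b ×ˢ Ioo c d) := 
  (hF.continuousOn.integrableOn_compact (isCompact_Icc.prod isCompact_Icc)).mono_set
    (prod_mono (Ioo_subset_Icc_self (a := a) (b := b)) (Ioo_subset_Icc_self (a := c) (b := d)))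

theorem aux_2d (a b c d : ℝ) (hcd : c < d) (F G : ℝ × ℝ → ℝ) (hF : Continuous F)
    (hG : Continuous G) (hd : ∀ x y, HasDerivAt (fun y => F (x, y)) (G (x, y)) y)
    (h0 : ∀ x ∈ Ioo a b, F (x, c) = 0) :
    √(∫ p in Ioo a b ×ˢ Ioo c d, F p ^ 2) ≤ (d - c) * √(∫ p in Ioo a b ×ˢ Ioo c d, G p ^ 2) := by
  have iF := aux_int a b c d (fun p => F p ^ 2) (by fun_prop)
  have iG := aux_int a b c d (fun p => G p ^ 2) (by fun_prop)
  have key : ∫ p in Ioo a b ×ˢ Ioo c d, F p ^ 2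
      ≤ (d - c) ^ 2 * ∫ p in Ioo a b ×ˢ Ioo c d, G p ^ 2 := by
    rw [Measure.volume_eq_prod] at iF iG ⊢
    rw [setIntegral_prod _ iF, setIntegral_prod _ iG, ← integral_const_mul]
    rw [IntegrableOn, ← Measure.prod_restrict] at iF iG
    refine setIntegral_mono_on iF.integral_prod_left (iG.integral_prod_left.const_mul _)
      measurableSet_Ioo ?_
    intro x hx
    exact aux_1d c d hcd _ _ (by fun_prop) (hd x) (h0 x hx)
  calc _ ≤ _ := Real.sqrt_le_sqrt key
    _ = _ := by rw [Real.sqrt_mul (sq_nonneg _), Real.sqrt_sq (by linarith)]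

theorem aux_2d' (a b c d : ℝ) (hab : a < b) (F G : ℝ × ℝ → ℝ) (hF : Continuous F)
    (hG : Continuous G) (hd : ∀ x y, HasDerivAt (fun x => F (x, y)) (G (x, y)) x)
    (h0 : ∀ y ∈ Ioo c d, F (a, y) = 0) :
    √(∫ p in Ioo a b ×ˢ Ioo c d, F p ^ 2) ≤ (b - a) * √(∫ p in Ioo a b ×ˢ Ioo c d, G p ^ 2) := by
  have := aux_2d c d a b hab (fun p => F p.swap) (fun p => G p.swap) (by fun_prop) (by fun_prop)
    (fun x y => hd y x) h0
  rw [Measure.volume_eq_prod] at this ⊢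
  rwa [setIntegral_prod_swap (Ioo a b) (Ioo c d) (fun p => F p ^ 2),
    setIntegral_prod_swap (Ioo a b) (Ioo c d) (fun p => G p ^ 2)] at this

theorem hasDeriv_x (v : ℝ × ℝ → ℝ) (hv : Differentiable ℝ v) (x y : ℝ) :
    HasDerivAt (fun x => v (x, y)) (fderiv ℝ v (x, y) (1, 0)) x :=
  HasFDerivAt.comp_hasDerivAt x (hv (x, y)).hasFDerivAt
    ((hasDerivAt_id x).prodMk (hasDerivAt_const x y))

theorem hasDeriv_y (v : ℝ × ℝ → ℝ) (hv : Differentiable ℝ v) (x y : ℝ) :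
    HasDerivAt (fun y => v (x, y)) (fderiv ℝ v (x, y) (0, 1)) y :=
  HasFDerivAt.comp_hasDerivAt y (hv (x, y)).hasFDerivAt
    ((hasDerivAt_const y x).prodMk (hasDerivAt_id y))

theorem pdx_eq (v : ℝ × ℝ → ℝ) (hv : Differentiable ℝ v) :
    pdx v = fun p => fderiv ℝ v p (1, 0) := by
  funext p; exact (hasDeriv_x v hv p.1 p.2).deriv

theorem pdy_eq (v : ℝ × ℝ → ℝ) (hv : Differentiable ℝ v) :
    pdy v = fun p => fderiv ℝ v p (0, 1) := by
  funext p; exact (hasDeriv_y v hv p.1 p.2).deriv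

theorem pdx_cd (n : ℕ) (v : ℝ × ℝ → ℝ) (hv : ContDiff ℝ (n + 1) v) : ContDiff ℝ n (pdx v) := by
  rw [pdx_eq v (hv.differentiable (by simp))]
  exact (hv.fderiv_right le_rfl).clm_apply contDiff_const

theorem pdy_cd (n : ℕ) (v : ℝ × ℝ → ℝ) (hv : ContDiff ℝ (n + 1) v) : ContDiff ℝ n (pdy v) := by
  rw [pdy_eq v (hv.differentiable (by simp))]
  exact (hv.fderiv_right le_rfl).clm_apply contDiff_const

theorem pd_comm (v : ℝ × ℝ → ℝ) (hv : ContDiff ℝ 2 v) : pdy (pdx v) = pdx (pdy v) := by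
  have h1 : ContDiff ℝ (1 + 1 : ℕ) v := by exact_mod_cast hv
  have hdf : Differentiable ℝ (fderiv ℝ v) :=
    (hv.fderiv_right (m := 1) (by norm_num)).differentiable (by simp)
  have hx := pdx_cd 1 v (by exact_mod_cast hv)
  have hy := pdy_cd 1 v (by exact_mod_cast hv)
  have hvd := hv.differentiable (by simp)
  rw [pdy_eq _ (hx.differentiable (by simp)), pdx_eq _ (hy.differentiable (by simp)),
    pdx_eq v hvd, pdy_eq v hvd]
  funext p
  have hs := (hv.contDiffAt (x := p)).isSymmSndFDerivAt (by simp)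
  have e : ∀ w : ℝ × ℝ, fderiv ℝ (fun p => fderiv ℝ v p w) p
      = (fderiv ℝ (fderiv ℝ v) p).flip w := by
    intro w
    rw [fderiv_clm_apply (hdf p) (differentiableAt_const w)]
    simp
  rw [e, e]
  exact hs.eq _ _

theorem pdx_zero (a b y : ℝ) (v : ℝ × ℝ → ℝ) (h : ∀ x ∈ Ioo a b, v (x, y) = 0) :
    ∀ x ∈ Ioo a b, pdx v (x, y) = 0 := by
  intro x hx
  have : (fun x => v (x, y)) =ᶠ[nhds x] fun _ => 0 := by
    filter_upwards [isOpen_Ioo.mem_nhds hx] with t ht using h t ht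
  simpa [pdx] using this.deriv_eq

theorem pdy_zero (c d x : ℝ) (v : ℝ × ℝ → ℝ) (h : ∀ y ∈ Ioo c d, v (x, y) = 0) :
    ∀ y ∈ Ioo c d, pdy v (x, y) = 0 := by
  intro y hy
  have : (fun y => v (x, y)) =ᶠ[nhds y] fun _ => 0 := by
    filter_upwards [isOpen_Ioo.mem_nhds hy] with t ht using h t ht
  simpa [pdy] using this.deriv_eq

theorem stmt_0 (a b c d : ℝ) (hab : a < b) (hcd : c < d)
    (v : ℝ × ℝ → ℝ) (hv : ContDiff ℝ 3 v)
    (hbc1 : ∀ x ∈ Icc a b, v (x, c) = 0 ∧ v (x, d) = 0)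
    (hbc2 : ∀ y ∈ Icc c d, v (a, y) = 0 ∧ v (b, y) = 0) :
    Real.sqrt (∫ p in (Ioo a b) ×ˢ (Ioo c d),
        (pdx (pdx v) p + pdy (pdy v) p) ^ 2) ≤
      (d - c) * Real.sqrt (∫ p in (Ioo a b) ×ˢ (Ioo c d), (pdx (pdx (pdy v)) p) ^ 2) +
      (b - a) * Real.sqrt (∫ p in (Ioo a b) ×ˢ (Ioo c d), (pdx (pdy (pdy v)) p) ^ 2) := by
  have hv2 : ContDiff ℝ 2 v := hv.of_le (by norm_num)
  have cx := pdx_cd 2 v (by exact_mod_cast hv)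
  have cy := pdy_cd 2 v (by exact_mod_cast hv)
  have cxx := pdx_cd 1 (pdx v) (by exact_mod_cast cx)
  have cyy := pdy_cd 1 (pdy v) (by exact_mod_cast cy)
  have cxy := pdx_cd 1 (pdy v) (by exact_mod_cast cy)
  have cxxy := pdx_cd 0 (pdx (pdy v)) (by exact_mod_cast cxy)
  have cxyy := pdx_cd 0 (pdy (pdy v)) (by exact_mod_cast cyy)
  have com : pdy (pdx (pdx v)) = pdx (pdx (pdy v)) := by
    rw [pd_comm (pdx v) (by exact_mod_cast cx), pd_comm v hv2]
  have hFc := cxx.continuous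
  have hHc := cyy.continuous
  have h1 := aux_2d a b c d hcd (pdx (pdx v)) (pdx (pdx (pdy v))) hFc cxxy.continuous
    (by
      intro x y
      have hd := cxx.differentiable (by simp)
      rw [← com, pdy_eq _ hd]
      exact hasDeriv_y _ hd x y)
    (pdx_zero a b c _ (pdx_zero a b c _ fun x hx => (hbc1 x (Ioo_subset_Icc_self hx)).1))
  have h2 := aux_2d' a b c d hab (pdy (pdy v)) (pdx (pdy (pdy v))) hHc cxyy.continuous
    (by
      intro x y
      have hd := cyy.differentiable (by simp)
      rw [pdx_eq _ hd]
      exact hasDeriv_x _ hd x y)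
    (pdy_zero c d a _ (pdy_zero c d a _ fun x hx => (hbc2 x (Ioo_subset_Icc_self hx)).1))
  have h3 := aux_mink (volume.restrict (Ioo a b ×ˢ Ioo c d)) (pdx (pdx v)) (pdy (pdy v))
    (aux_int a b c d _ (by fun_prop)) (aux_int a b c d _ (by fun_prop))
    (aux_int a b c d _ (by fun_prop))
  exact h3.trans (add_le_add h1 h2)
end

section
/- Let Ω = (a,b)×(c,d) with a < b and c < d, and let α > 0, γ ≥ 0, β₁, β₂ ∈ ℝ. Then there exists a constant C > 0, depending only on α, β₁, β₂, γ, a, b, c, d, such that every four times continuously differentiable function v : ℝ² → ℝ vanishing on ∂Ω satisfies ∫_Ω (Δv)² + ∫_Ω (v_xxy)² + ∫_Ω (v_xyy)² ≤ C · ( |∫_Ω (−α Δv + β₁ v_x + β₂ v_y + γ v) · v_xxyy| + ∫_Ω v² ). -/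
open MeasureTheory Set

namespace S5

open intervalIntegral

lemma pdx_eq {v : ℝ × ℝ → ℝ} (hv : Differentiable ℝ v) :
    pdx v = fun p => fderiv ℝ v p (1, 0) := by
  funext p
  have h1 : HasDerivAt (fun x : ℝ => (x, p.2)) ((1 : ℝ), (0 : ℝ)) p.1 :=
    (hasDerivAt_id p.1).prodMk (hasDerivAt_const _ _)
  have h2 : HasFDerivAt v (fderiv ℝ v p) (p.1, p.2) := (hv p).hasFDerivAt
  exact (h2.comp_hasDerivAt p.1 h1).deriv

lemma pdy_eq {v : ℝ × ℝ → ℝ} (hv : Differentiable ℝ v) :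
    pdy v = fun p => fderiv ℝ v p (0, 1) := by
  funext p
  have h1 : HasDerivAt (fun y : ℝ => (p.1, y)) ((0 : ℝ), (1 : ℝ)) p.2 :=
    (hasDerivAt_const _ _).prodMk (hasDerivAt_id p.2)
  have h2 : HasFDerivAt v (fderiv ℝ v p) (p.1, p.2) := (hv p).hasFDerivAt
  exact (h2.comp_hasDerivAt p.2 h1).deriv

lemma ne_aux {m n : WithTop ℕ∞} (h : m + 1 ≤ n) : n ≠ 0 := by
  rintro rfl
  have : (1 : WithTop ℕ∞) ≤ 0 := le_trans (by simp) h
  simp at this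

lemma cd_x {v : ℝ × ℝ → ℝ} {m n : WithTop ℕ∞} (hv : ContDiff ℝ n v) (h : m + 1 ≤ n) :
    ContDiff ℝ m (pdx v) := by
  rw [pdx_eq (hv.differentiable (ne_aux h))]
  exact (hv.fderiv_right h).clm_apply contDiff_const

lemma cd_y {v : ℝ × ℝ → ℝ} {m n : WithTop ℕ∞} (hv : ContDiff ℝ n v) (h : m + 1 ≤ n) :
    ContDiff ℝ m (pdy v) := by
  rw [pdy_eq (hv.differentiable (ne_aux h))]
  exact (hv.fderiv_right h).clm_apply contDiff_const

lemma comm {v : ℝ × ℝ → ℝ} (hv : ContDiff ℝ 2 v) : pdx (pdy v) = pdy (pdx v) := by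
  have hd : Differentiable ℝ v := hv.differentiable (by norm_num)
  have h1 : ContDiff ℝ 1 (fderiv ℝ v) := hv.fderiv_right (by norm_num)
  have h1d : Differentiable ℝ (fderiv ℝ v) := h1.differentiable (by norm_num)
  rw [pdx_eq ((cd_y (m := 1) hv (by norm_num)).differentiable (by norm_num)),
    pdy_eq ((cd_x (m := 1) hv (by norm_num)).differentiable (by norm_num)),
    pdx_eq hd, pdy_eq hd]
  funext p
  have hs : IsSymmSndFDerivAt ℝ v p := by
    apply (hv.contDiffAt).isSymmSndFDerivAt
    simp
  rw [fderiv_clm_apply (h1d p) (by fun_prop), fderiv_clm_apply (h1d p) (by fun_prop)]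
  simpa using hs.eq (1, 0) (0, 1)

lemma hd_x {f : ℝ × ℝ → ℝ} (hf : ContDiff ℝ 1 f) (x y : ℝ) :
    HasDerivAt (fun x => f (x, y)) (pdx f (x, y)) x := by
  have : Differentiable ℝ f := hf.differentiable (by norm_num)
  have h : DifferentiableAt ℝ (fun x => f (x, y)) x := by fun_prop
  exact h.hasDerivAt

lemma hd_y {f : ℝ × ℝ → ℝ} (hf : ContDiff ℝ 1 f) (x y : ℝ) :
    HasDerivAt (fun y => f (x, y)) (pdy f (x, y)) y := by
  have : Differentiable ℝ f := hf.differentiable (by norm_num)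
  have h : DifferentiableAt ℝ (fun y => f (x, y)) y := by fun_prop
  exact h.hasDerivAt

lemma int_on {f : ℝ × ℝ → ℝ} (hf : Continuous f) (a b c d : ℝ) :
    IntegrableOn f (Ioo a b ×ˢ Ioo c d) := by
  have : IntegrableOn f (Icc a b ×ˢ Icc c d) :=
    hf.continuousOn.integrableOn_compact (isCompact_Icc.prod isCompact_Icc)
  exact this.mono_set (prod_mono Ioo_subset_Icc_self Ioo_subset_Icc_self)

lemma fub1 {f : ℝ × ℝ → ℝ} (hf : Continuous f) (a b c d : ℝ) :
    ∫ p in Ioo a b ×ˢ Ioo c d, f p = ∫ x in Ioo a b, ∫ y in Ioo c d, f (x, y) := by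
  have := int_on hf a b c d
  rw [Measure.volume_eq_prod] at this ⊢
  exact setIntegral_prod f this

lemma fub2 {f : ℝ × ℝ → ℝ} (hf : Continuous f) (a b c d : ℝ) :
    ∫ p in Ioo a b ×ˢ Ioo c d, f p = ∫ y in Ioo c d, ∫ x in Ioo a b, f (x, y) := by
  have := int_on hf a b c d
  rw [fub1 hf]
  rw [Measure.volume_eq_prod, IntegrableOn, ← Measure.prod_restrict] at this
  exact integral_integral_swap this

lemma ibp1 {u v u' v' : ℝ → ℝ} {a b : ℝ} (hab : a < b) (hu : ∀ x, HasDerivAt u (u' x) x)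
    (hv : ∀ x, HasDerivAt v (v' x) x) (cu : Continuous u') (cv : Continuous v')
    (ha : u a = 0) (hb : u b = 0) :
    ∫ x in Ioo a b, u x * v' x = - ∫ x in Ioo a b, u' x * v x := by
  rw [← integral_Ioc_eq_integral_Ioo, ← integral_Ioc_eq_integral_Ioo,
    ← integral_of_le hab.le, ← integral_of_le hab.le,
    integral_mul_deriv_eq_deriv_mul (fun x _ => hu x) (fun x _ => hv x)
      (cu.intervalIntegrable _ _) (cv.intervalIntegrable _ _), ha, hb]
  ring

lemma ibp_x {f g : ℝ × ℝ → ℝ} {a b c d : ℝ} (hab : a < b) (hf : ContDiff ℝ 1 f)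
    (hg : ContDiff ℝ 1 g) (ha : ∀ y ∈ Ioo c d, f (a, y) = 0) (hb : ∀ y ∈ Ioo c d, f (b, y) = 0) :
    ∫ p in Ioo a b ×ˢ Ioo c d, f p * pdx g p = - ∫ p in Ioo a b ×ˢ Ioo c d, pdx f p * g p := by
  have cf := (cd_x (m := 0) hf (by norm_num)).continuous
  have cg := (cd_x (m := 0) hg (by norm_num)).continuous
  have cf0 := hf.continuous
  have cg0 := hg.continuous
  rw [fub2 (by fun_prop), fub2 (by fun_prop), ← MeasureTheory.integral_neg]
  refine setIntegral_congr_fun measurableSet_Ioo fun y hy => ?_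
  exact ibp1 hab (fun x => hd_x hf x y) (fun x => hd_x hg x y) (by fun_prop) (by fun_prop)
    (ha y hy) (hb y hy)

lemma ibp_y {f g : ℝ × ℝ → ℝ} {a b c d : ℝ} (hcd : c < d) (hf : ContDiff ℝ 1 f)
    (hg : ContDiff ℝ 1 g) (hc : ∀ x ∈ Ioo a b, f (x, c) = 0) (hd : ∀ x ∈ Ioo a b, f (x, d) = 0) :
    ∫ p in Ioo a b ×ˢ Ioo c d, f p * pdy g p = - ∫ p in Ioo a b ×ˢ Ioo c d, pdy f p * g p := by
  have cf := (cd_y (m := 0) hf (by norm_num)).continuous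
  have cg := (cd_y (m := 0) hg (by norm_num)).continuous
  have cf0 := hf.continuous
  have cg0 := hg.continuous
  rw [fub1 (by fun_prop), fub1 (by fun_prop), ← MeasureTheory.integral_neg]
  refine setIntegral_congr_fun measurableSet_Ioo fun x hx => ?_
  exact ibp1 hcd (fun y => hd_y hf x y) (fun y => hd_y hg x y) (by fun_prop) (by fun_prop)
    (hc x hx) (hd x hx)

lemma bd_y {f : ℝ × ℝ → ℝ} {a c d : ℝ} (h : ∀ y ∈ Ioo c d, f (a, y) = 0) :
    ∀ y ∈ Ioo c d, pdy f (a, y) = 0 := by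
  intro y hy
  have : (fun y => f (a, y)) =ᶠ[nhds y] fun _ => 0 := by
    filter_upwards [isOpen_Ioo.mem_nhds hy] with z hz using h z hz
  simpa [pdy] using this.deriv_eq

lemma bd_x {f : ℝ × ℝ → ℝ} {a b c : ℝ} (h : ∀ x ∈ Ioo a b, f (x, c) = 0) :
    ∀ x ∈ Ioo a b, pdx f (x, c) = 0 := by
  intro x hx
  have : (fun x => f (x, c)) =ᶠ[nhds x] fun _ => 0 := by
    filter_upwards [isOpen_Ioo.mem_nhds hx] with z hz using h z hz
  simpa [pdx] using this.deriv_eq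

/-- weighted Young inequality with an integrated product -/
lemma young {f g : ℝ × ℝ → ℝ} (hf : Continuous f) (hg : Continuous g) (a b c d e s : ℝ)
    (he : 0 < e) :
    s * ∫ p in Ioo a b ×ˢ Ioo c d, f p * g p ≤
      e * (∫ p in Ioo a b ×ˢ Ioo c d, g p ^ 2) +
        s ^ 2 / (4 * e) * ∫ p in Ioo a b ×ˢ Ioo c d, f p ^ 2 := by
  rw [← MeasureTheory.integral_const_mul, ← MeasureTheory.integral_const_mul,
    ← MeasureTheory.integral_const_mul, ← MeasureTheory.integral_add]
  · refine setIntegral_mono (int_on (by fun_prop) _ _ _ _) (int_on (by fun_prop) _ _ _ _) ?_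
    intro p
    have : e * g p ^ 2 + s ^ 2 / (4 * e) * f p ^ 2 - s * (f p * g p)
        = e * (g p - s / (2 * e) * f p) ^ 2 := by
      field_simp; ring
    have h2 : 0 ≤ e * (g p - s / (2 * e) * f p) ^ 2 := by positivity
    show s * (f p * g p) ≤ e * g p ^ 2 + s ^ 2 / (4 * e) * f p ^ 2
    linarith
  · exact int_on (by fun_prop) _ _ _ _
  · exact int_on (by fun_prop) _ _ _ _

lemma poinc_core {f g t : ℝ × ℝ → ℝ} (hf : Continuous f) (hg : Continuous g) {a b c d : ℝ}
    (ht : Continuous t) {L : ℝ} (hL : ∀ p ∈ Ioo a b ×ˢ Ioo c d, t p ^ 2 ≤ L ^ 2)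
    (h : ∫ p in Ioo a b ×ˢ Ioo c d, f p ^ 2 = - ∫ p in Ioo a b ×ˢ Ioo c d, 2 * f p * g p * t p) :
    ∫ p in Ioo a b ×ˢ Ioo c d, f p ^ 2 ≤ 4 * L ^ 2 * ∫ p in Ioo a b ×ˢ Ioo c d, g p ^ 2 := by
  have key : - ∫ p in Ioo a b ×ˢ Ioo c d, 2 * f p * g p * t p ≤
      1 / 2 * (∫ p in Ioo a b ×ˢ Ioo c d, f p ^ 2) +
        2 * L ^ 2 * ∫ p in Ioo a b ×ˢ Ioo c d, g p ^ 2 := by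
    rw [← MeasureTheory.integral_neg, ← MeasureTheory.integral_const_mul,
      ← MeasureTheory.integral_const_mul, ← MeasureTheory.integral_add]
    · refine setIntegral_mono_on (int_on (by fun_prop) _ _ _ _) (int_on (by fun_prop) _ _ _ _)
        (measurableSet_Ioo.prod measurableSet_Ioo) ?_
      intro p hp
      nlinarith [sq_nonneg (f p + 2 * g p * t p),
        mul_le_mul_of_nonneg_right (hL p hp) (sq_nonneg (g p))]
    · exact int_on (by fun_prop) _ _ _ _
    · exact int_on (by fun_prop) _ _ _ _
  linarith

lemma poinc_x {f : ℝ × ℝ → ℝ} {a b c d : ℝ} (hab : a < b) (hf : ContDiff ℝ 1 f)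
    (ha : ∀ y ∈ Ioo c d, f (a, y) = 0) (hb : ∀ y ∈ Ioo c d, f (b, y) = 0) :
    ∫ p in Ioo a b ×ˢ Ioo c d, f p ^ 2 ≤
      4 * (b - a) ^ 2 * ∫ p in Ioo a b ×ˢ Ioo c d, pdx f p ^ 2 := by
  have cf := (cd_x (m := 0) hf (by norm_num)).continuous
  refine poinc_core (t := fun p => p.1 - a) hf.continuous cf (by fun_prop) ?_ ?_
  · rintro p ⟨⟨h1, h2⟩, -⟩
    show (p.1 - a) ^ 2 ≤ _
    nlinarith
  · have := ibp_x (f := fun p => f p ^ 2) (g := fun p => p.1 - a) (c := c) (d := d) hab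
      (by fun_prop) (by fun_prop) (fun y hy => by simp [ha y hy]) (fun y hy => by simp [hb y hy])
    have e1 : ∀ p, pdx (fun p : ℝ × ℝ => p.1 - a) p = 1 := by intro p; simp [pdx]
    have e2 : ∀ p, pdx (fun p => f p ^ 2) p = 2 * f p * pdx f p := by
      intro p
      have := ((hd_x hf p.1 p.2).fun_pow 2).deriv
      simpa [pdx] using this
    simpa only [e1, e2, mul_one] using this

lemma poinc_y {f : ℝ × ℝ → ℝ} {a b c d : ℝ} (hcd : c < d) (hf : ContDiff ℝ 1 f)
    (hc : ∀ x ∈ Ioo a b, f (x, c) = 0) (hd : ∀ x ∈ Ioo a b, f (x, d) = 0) :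
    ∫ p in Ioo a b ×ˢ Ioo c d, f p ^ 2 ≤
      4 * (d - c) ^ 2 * ∫ p in Ioo a b ×ˢ Ioo c d, pdy f p ^ 2 := by
  have cf := (cd_y (m := 0) hf (by norm_num)).continuous
  refine poinc_core (t := fun p => p.2 - c) hf.continuous cf (by fun_prop) ?_ ?_
  · rintro p ⟨-, ⟨h1, h2⟩⟩
    show (p.2 - c) ^ 2 ≤ _
    nlinarith
  · have := ibp_y (f := fun p => f p ^ 2) (g := fun p => p.2 - c) (a := a) (b := b) hcd
      (by fun_prop) (by fun_prop) (fun y hy => by simp [hc y hy]) (fun y hy => by simp [hd y hy])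
    have e1 : ∀ p, pdy (fun p : ℝ × ℝ => p.2 - c) p = 1 := by intro p; simp [pdy]
    have e2 : ∀ p, pdy (fun p => f p ^ 2) p = 2 * f p * pdy f p := by
      intro p
      have := ((hd_y hf p.1 p.2).fun_pow 2).deriv
      simpa [pdy] using this
    simpa only [e1, e2, mul_one] using this

lemma final_arith (α K L L' : ℝ) (hα : 0 < α) (hK : 0 ≤ K) (hL : 0 < L) (hL' : 0 < L') :
    ∃ C e δ : ℝ, 0 < C ∧ 0 < e ∧ 0 < δ ∧ ∀ A B P G H H' D I R : ℝ, 0 ≤ A → 0 ≤ B → 0 ≤ P → 0 ≤ D →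
      0 ≤ I → α * 3 / 4 * (A + B) ≤ I + K * P → P ≤ e * A + 1 / (4 * e) * G →
      G ≤ δ * H + 1 / (4 * δ) * D → H ≤ L * B → H' ≤ L' * A → R ≤ 2 * H' + 2 * H →
      R + A + B ≤ C * (I + D) := by
  obtain ⟨M, hM⟩ : ∃ M, M = K + 1 := ⟨_, rfl⟩
  have hM0 : 0 < M := by linarith
  obtain ⟨e, he⟩ : ∃ e, e = α / (4 * M) := ⟨_, rfl⟩
  have he0 : 0 < e := by rw [he]; positivity
  obtain ⟨m, hm⟩ : ∃ m, m = 1 / (4 * e) := ⟨_, rfl⟩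
  have hm0 : 0 < m := by rw [hm]; positivity
  obtain ⟨δ, hδ⟩ : ∃ δ, δ = α / (4 * M * m * L) := ⟨_, rfl⟩
  have hδ0 : 0 < δ := by rw [hδ]; positivity
  obtain ⟨n, hn⟩ : ∃ n, n = 1 / (4 * δ) := ⟨_, rfl⟩
  have hn0 : 0 < n := by rw [hn]; positivity
  have e1 : M * e = α / 4 := by rw [he]; field_simp
  have e2 : M * m * δ * L = α / 4 := by rw [hδ]; field_simp
  refine ⟨(2 * L + 2 * L' + 1) * (2 / α) * (1 + M * m * n), e, δ, by positivity, he0, hδ0, ?_⟩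
  intro A B P G H H' D I R hA hB hP hD hI h1 h2 h3 h4 h5 h6
  rw [← hm] at h2
  rw [← hn] at h3
  have k1 : M * P ≤ α / 4 * A + M * m * G := by
    have := mul_le_mul_of_nonneg_left h2 hM0.le
    rw [← e1]; linarith
  have k2 : M * m * G ≤ M * m * δ * H + M * m * n * D := by
    have := mul_le_mul_of_nonneg_left h3 (mul_pos hM0 hm0).le
    linarith
  have k3 : M * m * δ * H ≤ α / 4 * B := by
    have := mul_le_mul_of_nonneg_left h4 (mul_pos (mul_pos hM0 hm0) hδ0).le
    rw [← e2]; linarith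
  have k4 : K * P ≤ M * P := by rw [hM]; linarith
  have k5 : α / 2 * (A + B) ≤ I + M * m * n * D := by linarith
  have hQ : 0 < M * m * n := by positivity
  have k6 : A + B ≤ 2 / α * ((1 + M * m * n) * (I + D)) := by
    have : I + M * m * n * D ≤ (1 + M * m * n) * (I + D) := by
      nlinarith [mul_nonneg hQ.le hI]
    have t := mul_le_mul_of_nonneg_left (k5.trans this) (by positivity : 0 ≤ 2 / α)
    have : 2 / α * (α / 2 * (A + B)) = A + B := by field_simp
    linarith
  have k7 : R + A + B ≤ (2 * L + 2 * L' + 1) * (A + B) := by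
    nlinarith [mul_nonneg hL.le hA, mul_nonneg hL'.le hB]
  calc R + A + B ≤ (2 * L + 2 * L' + 1) * (A + B) := k7
    _ ≤ (2 * L + 2 * L' + 1) * (2 / α * ((1 + M * m * n) * (I + D))) :=
        mul_le_mul_of_nonneg_left k6 (by positivity)
    _ = _ := by ring

end S5

theorem stmt_5 (a b c d : ℝ) (hab : a < b) (hcd : c < d) (α γ β₁ β₂ : ℝ)
    (hα : 0 < α) (hγ : 0 ≤ γ) :
    ∃ C : ℝ, 0 < C ∧
      ∀ v : ℝ × ℝ → ℝ, ContDiff ℝ 4 v →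
        (∀ x ∈ Icc a b, v (x, c) = 0 ∧ v (x, d) = 0) →
        (∀ y ∈ Icc c d, v (a, y) = 0 ∧ v (b, y) = 0) →
        (∫ p in (Ioo a b) ×ˢ (Ioo c d), (pdx (pdx v) p + pdy (pdy v) p) ^ 2) +
            (∫ p in (Ioo a b) ×ˢ (Ioo c d), (pdx (pdx (pdy v)) p) ^ 2) +
            (∫ p in (Ioo a b) ×ˢ (Ioo c d), (pdx (pdy (pdy v)) p) ^ 2) ≤
          C * (|∫ p in (Ioo a b) ×ˢ (Ioo c d),
                  (-α * (pdx (pdx v) p + pdy (pdy v) p) + β₁ * pdx v p + β₂ * pdy v p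
                      + γ * v p) * pdx (pdx (pdy (pdy v))) p| +
                ∫ p in (Ioo a b) ×ˢ (Ioo c d), (v p) ^ 2) := by
  obtain ⟨C, e, δ, hC, he, hδ, key⟩ := S5.final_arith α ((β₁ ^ 2 + β₂ ^ 2) / α) (4 * (b - a) ^ 2)
    (4 * (d - c) ^ 2) hα (by positivity) (by have := sub_pos.2 hab; positivity)
    (by have := sub_pos.2 hcd; positivity)
  refine ⟨C, hC, fun v hv hvy hvx => ?_⟩
  have bc : ∀ x ∈ Ioo a b, v (x, c) = 0 := fun x hx => (hvy x (Ioo_subset_Icc_self hx)).1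
  have bd : ∀ x ∈ Ioo a b, v (x, d) = 0 := fun x hx => (hvy x (Ioo_subset_Icc_self hx)).2
  have ba : ∀ y ∈ Ioo c d, v (a, y) = 0 := fun y hy => (hvx y (Ioo_subset_Icc_self hy)).1
  have bb : ∀ y ∈ Ioo c d, v (b, y) = 0 := fun y hy => (hvx y (Ioo_subset_Icc_self hy)).2
  have rx : ContDiff ℝ 3 (pdx v) := S5.cd_x hv (by norm_num)
  have ry : ContDiff ℝ 3 (pdy v) := S5.cd_y hv (by norm_num)
  have rxx : ContDiff ℝ 2 (pdx (pdx v)) := S5.cd_x rx (by norm_num)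
  have ryy : ContDiff ℝ 2 (pdy (pdy v)) := S5.cd_y ry (by norm_num)
  have rxy : ContDiff ℝ 2 (pdx (pdy v)) := S5.cd_x ry (by norm_num)
  have rxxy : ContDiff ℝ 1 (pdx (pdx (pdy v))) := S5.cd_x rxy (by norm_num)
  have rxyy : ContDiff ℝ 1 (pdx (pdy (pdy v))) := S5.cd_x ryy (by norm_num)
  have rw4 : ContDiff ℝ 0 (pdx (pdx (pdy (pdy v)))) := S5.cd_x rxyy (by norm_num)
  have c1 : pdy (pdx v) = pdx (pdy v) := (S5.comm (hv.of_le (by norm_num))).symm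
  have c2 : pdy (pdx (pdx v)) = pdx (pdx (pdy v)) := by
    rw [← S5.comm (rx.of_le (by norm_num)), c1]
  have c3 : pdy (pdx (pdy v)) = pdx (pdy (pdy v)) := (S5.comm (ry.of_le (by norm_num))).symm
  have c4 : pdy (pdx (pdx (pdy v))) = pdx (pdx (pdy (pdy v))) := by
    rw [← S5.comm rxy, c3]
  have k0 := hv.continuous
  have kx := rx.continuous
  have ky := ry.continuous
  have kxx := rxx.continuous
  have kyy := ryy.continuous
  have kxy := rxy.continuous
  have kxxy := rxxy.continuous
  have kxyy := rxyy.continuous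
  have kw := rw4.continuous
  have i1 := S5.ibp_y hcd (rxx.of_le (by norm_num)) rxxy (S5.bd_x (S5.bd_x bc)) (S5.bd_x (S5.bd_x bd))
  have i2 := S5.ibp_x hab (ryy.of_le (by norm_num)) rxyy (S5.bd_y (S5.bd_y ba)) (S5.bd_y (S5.bd_y bb))
  have i3 := S5.ibp_y hcd (rx.of_le (by norm_num)) rxxy (S5.bd_x bc) (S5.bd_x bd)
  have i4 := S5.ibp_x hab (ry.of_le (by norm_num)) rxyy (S5.bd_y ba) (S5.bd_y bb)
  have i5 := S5.ibp_x hab (hv.of_le (by norm_num)) rxyy ba bb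
  have i5' := S5.ibp_y hcd (rx.of_le (by norm_num)) (rxy.of_le (by norm_num)) (S5.bd_x bc) (S5.bd_x bd)
  have i6 := S5.ibp_x hab (ry.of_le (by norm_num)) (rxy.of_le (by norm_num)) (S5.bd_y ba) (S5.bd_y bb)
  have i7 := S5.ibp_y hcd (hv.of_le (by norm_num)) (ry.of_le (by norm_num)) bc bd
  rw [c2, c4] at i1
  rw [c1, c4] at i3
  rw [c1, c3] at i5'
  have p1 := S5.poinc_x hab (ryy.of_le (by norm_num)) (S5.bd_y (S5.bd_y ba)) (S5.bd_y (S5.bd_y bb))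
  have p2 := S5.poinc_y hcd (rxx.of_le (by norm_num)) (S5.bd_x (S5.bd_x bc)) (S5.bd_x (S5.bd_x bd))
  rw [c2] at p2
  have y1 := S5.young kxy kxxy a b c d (α / 4) β₁ (by positivity)
  have y2 := S5.young kxy kxyy a b c d (α / 4) β₂ (by positivity)
  have y3 := S5.young ky kxxy a b c d e (-1) he
  have y4 := S5.young k0 kyy a b c d δ (-1) hδ
  simp only [← pow_two] at i1 i2 i5 i5' i6 i7
  have sI : ∀ f : ℝ × ℝ → ℝ, 0 ≤ ∫ p in Ioo a b ×ˢ Ioo c d, f p ^ 2 :=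
    fun f => integral_nonneg fun p => sq_nonneg _
  have hI : (∫ p in (Ioo a b) ×ˢ (Ioo c d),
                  (-α * (pdx (pdx v) p + pdy (pdy v) p) + β₁ * pdx v p + β₂ * pdy v p
                      + γ * v p) * pdx (pdx (pdy (pdy v))) p)
      = -α * (∫ p in (Ioo a b) ×ˢ (Ioo c d), pdx (pdx v) p * pdx (pdx (pdy (pdy v))) p)
        + -α * (∫ p in (Ioo a b) ×ˢ (Ioo c d), pdy (pdy v) p * pdx (pdx (pdy (pdy v))) p)
        + β₁ * (∫ p in (Ioo a b) ×ˢ (Ioo c d), pdx v p * pdx (pdx (pdy (pdy v))) p)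
        + β₂ * (∫ p in (Ioo a b) ×ˢ (Ioo c d), pdy v p * pdx (pdx (pdy (pdy v))) p)
        + γ * (∫ p in (Ioo a b) ×ˢ (Ioo c d), v p * pdx (pdx (pdy (pdy v))) p) := by
    simp only [← MeasureTheory.integral_const_mul]
    rw [← MeasureTheory.integral_add, ← MeasureTheory.integral_add, ← MeasureTheory.integral_add,
      ← MeasureTheory.integral_add]
    · congr 1
      funext p
      ring
    all_goals exact S5.int_on (by fun_prop) _ _ _ _
  have hR : (∫ p in (Ioo a b) ×ˢ (Ioo c d), (pdx (pdx v) p + pdy (pdy v) p) ^ 2) ≤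
      2 * (∫ p in (Ioo a b) ×ˢ (Ioo c d), pdx (pdx v) p ^ 2) +
      2 * (∫ p in (Ioo a b) ×ˢ (Ioo c d), pdy (pdy v) p ^ 2) := by
    rw [← MeasureTheory.integral_const_mul, ← MeasureTheory.integral_const_mul,
      ← MeasureTheory.integral_add]
    · refine setIntegral_mono (S5.int_on (by fun_prop) _ _ _ _) (S5.int_on (by fun_prop) _ _ _ _) ?_
      intro p
      show (pdx (pdx v) p + pdy (pdy v) p) ^ 2 ≤ 2 * pdx (pdx v) p ^ 2 + 2 * pdy (pdy v) p ^ 2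
      nlinarith [sq_nonneg (pdx (pdx v) p - pdy (pdy v) p)]
    all_goals exact S5.int_on (by fun_prop) _ _ _ _
  refine key _ _ (∫ p in (Ioo a b) ×ˢ (Ioo c d), pdx (pdy v) p ^ 2)
    (∫ p in (Ioo a b) ×ˢ (Ioo c d), pdy v p ^ 2) _ _ _ _ _ (sI _) (sI _) (sI _) (sI _)
    (abs_nonneg _) ?_ ?_ ?_ p1 p2 hR
  · refine le_trans ?_ (add_le_add_left (le_abs_self _) _)
    rw [hI, i1, i2, i3, i4, i5, i5']
    have hg := mul_nonneg hγ (sI (pdx (pdy v)))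
    have f1 : β₁ ^ 2 / (4 * (α / 4)) = β₁ ^ 2 / α := by congr 1; ring
    have f2 : β₂ ^ 2 / (4 * (α / 4)) = β₂ ^ 2 / α := by congr 1; ring
    rw [f1] at y1
    rw [f2] at y2
    rw [add_div]
    linarith
  · have f : (-1 : ℝ) ^ 2 = 1 := by norm_num
    rw [f] at y3
    simp only [pow_two] at i6 y3 ⊢
    linarith
  · have f : (-1 : ℝ) ^ 2 = 1 := by norm_num
    rw [f] at y4
    simp only [pow_two] at i7 y4 ⊢
    linarith
end

section
/- For every integer n ≥ 4 there exists a polynomial q ∈ ℝ[X] of degree exactly n−4 such that J_n^{−2,−2} = (1−X)²(1+X)²·q. In particular, J_n^{−2,−2} has degree n, J_n^{−2,−2}(1) = J_n^{−2,−2}(−1) = 0, and the derivative satisfies (J_n^{−2,−2})′(1) = (J_n^{−2,−2})′(−1) = 0. -/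
open Polynomial

/-- The generalized Jacobi polynomial `J_n^{-2,-2}` for `n ≥ 4`, given by
`J_n^{-2,-2} = ((-1)^n / (2^(n-4) (n-4)!)) · D^(n-4)[(1 - X²)^(n-2)]`. -/
noncomputable def jacobiM2 (n : ℕ) : Polynomial ℝ :=
  Polynomial.C ((-1 : ℝ) ^ n / (2 ^ (n - 4) * (n - 4).factorial)) *
    (Polynomial.derivative^[n - 4] ((1 - Polynomial.X ^ 2) ^ (n - 2)))

theorem natDegree_base : (1 - X ^ 2 : ℝ[X]).natDegree = 2 := by
  compute_degree!

theorem degree_jac (k : ℕ) : (jacobiM2 (k + 4)).degree = ((k + 4 : ℕ) : WithBot ℕ) := by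
  have hd : ((1 - X ^ 2 : ℝ[X]) ^ (k + 2)).natDegree = k + 4 + k := by
    rw [natDegree_pow, natDegree_base]; ring
  have h0 : (1 - X ^ 2 : ℝ[X]) ≠ 0 := by
    intro h
    have := natDegree_base
    rw [h] at this
    simp at this
  unfold jacobiM2
  have e1 : k + 4 - 4 = k := by omega
  have e2 : k + 4 - 2 = k + 2 := by omega
  rw [e1, e2, degree_C_mul (by positivity)]
  apply degree_eq_of_le_of_coeff_ne_zero
  · apply degree_le_of_natDegree_le
    refine (natDegree_iterate_derivative _ _).trans ?_
    rw [hd]; omega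
  · rw [coeff_iterate_derivative, ← hd, nsmul_eq_mul]
    apply mul_ne_zero
    · rw [hd, Nat.cast_ne_zero]
      exact (Nat.descFactorial_pos.2 (by omega)).ne'
    · exact leadingCoeff_ne_zero.2 (pow_ne_zero _ h0)

theorem stmt_7 (n : ℕ) (hn : 4 ≤ n) :
    ∃ q : Polynomial ℝ, q.degree = ((n - 4 : ℕ) : WithBot ℕ) ∧
      jacobiM2 n = (1 - Polynomial.X) ^ 2 * (1 + Polynomial.X) ^ 2 * q ∧
      (jacobiM2 n).degree = (n : WithBot ℕ) ∧
      (jacobiM2 n).eval 1 = 0 ∧ (jacobiM2 n).eval (-1) = 0 ∧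
      (Polynomial.derivative (jacobiM2 n)).eval 1 = 0 ∧
      (Polynomial.derivative (jacobiM2 n)).eval (-1) = 0 := by
  obtain ⟨k, rfl⟩ : ∃ k, n = k + 4 := ⟨n - 4, by omega⟩
  have hdeg := degree_jac k
  have hdvd : (1 - X ^ 2 : ℝ[X]) ^ 2 ∣ jacobiM2 (k + 4) := by
    unfold jacobiM2
    apply Dvd.dvd.mul_left
    have := pow_sub_dvd_iterate_derivative_pow (1 - X ^ 2 : ℝ[X]) (k + 4 - 2) (k + 4 - 4)
    have e : k + 4 - 2 - (k + 4 - 4) = 2 := by omega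
    rwa [e] at this
  obtain ⟨q, hq⟩ := hdvd
  have hne : jacobiM2 (k + 4) ≠ 0 := by
    intro h
    rw [h, degree_zero] at hdeg
    exact absurd hdeg (WithBot.bot_ne_coe)
  have hq0 : q ≠ 0 := by
    rintro rfl
    simp at hq
    exact hne hq
  have hb0 : (1 - X ^ 2 : ℝ[X]) ^ 2 ≠ 0 := by
    intro h
    rw [h, zero_mul] at hq
    exact hne hq
  refine ⟨q, ?_, ?_, hdeg, ?_, ?_, ?_, ?_⟩
  · have hn' := natDegree_eq_of_degree_eq_some hdeg
    rw [hq, natDegree_mul hb0 hq0, natDegree_pow, natDegree_base] at hn'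
    rw [degree_eq_natDegree hq0]
    congr 1
    omega
  · rw [hq]; ring
  all_goals
    rw [hq]
    simp [derivative_mul, derivative_pow]
end

section
/- For every integer n ≥ 5 and every polynomial p ∈ ℝ[X] of degree at most n−5, ∫_{−1}^{1} J_n^{−2,−2}(s)·p(s) ds = 0 (that is, J_n^{−2,−2} is L²(−1,1)-orthogonal to all polynomials of degree at most n−5). -/
open Polynomial

theorem aux_orth (N k : ℕ) (hk : k ≤ N) : ∀ p : Polynomial ℝ, p.degree < (k : WithBot ℕ) →
    (∫ s in (-1 : ℝ)..1,
      p.eval s * (Polynomial.derivative^[k] ((1 - Polynomial.X ^ 2 : Polynomial ℝ) ^ N)).eval s) = 0 := by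
  induction k with
  | zero =>
    intro p hp
    have : p = 0 := by
      by_contra h
      rw [Polynomial.degree_eq_natDegree h] at hp
      exact absurd (by exact_mod_cast hp) (Nat.not_lt_zero p.natDegree)
    simp [this]
  | succ k ih =>
    intro p hp
    obtain ⟨q, hq⟩ : (1 - X ^ 2 : ℝ[X]) ∣ derivative^[k] ((1 - X ^ 2 : ℝ[X]) ^ N) :=
      (dvd_pow_self _ (by omega)).trans (pow_sub_dvd_iterate_derivative_pow _ N k)
    have h := intervalIntegral.integral_mul_deriv_eq_deriv_mul (a := -1) (b := 1)
      (u := fun s => p.eval s) (u' := fun s => p.derivative.eval s)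
      (v := fun s => (derivative^[k] ((1 - X ^ 2 : ℝ[X]) ^ N)).eval s)
      (v' := fun s => (derivative^[k+1] ((1 - X ^ 2 : ℝ[X]) ^ N)).eval s)
      (fun x _ => p.hasDerivAt x)
      (fun x _ => by
        rw [Function.iterate_succ_apply']
        exact Polynomial.hasDerivAt _ x)
      (Polynomial.continuous _).continuousOn.intervalIntegrable
      (Polynomial.continuous _).continuousOn.intervalIntegrable
    have hd : p.derivative.degree < (k : WithBot ℕ) := by
      by_cases h0 : p.natDegree = 0
      · rw [derivative_of_natDegree_zero h0, degree_zero]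
        exact WithBot.bot_lt_coe k
      · have hp0 : p ≠ 0 := by rintro rfl; simp at h0
        refine (degree_derivative_lt hp0).trans_le ?_
        rw [degree_eq_natDegree hp0] at hp ⊢
        have : p.natDegree < k + 1 := by exact_mod_cast hp
        exact_mod_cast Nat.lt_succ_iff.mp this
    rw [h, ih (by omega) _ hd, hq]
    simp

theorem stmt_8 (n : ℕ) (hn : 5 ≤ n) (p : Polynomial ℝ) (hp : p.degree ≤ ((n - 5 : ℕ) : WithBot ℕ)) :
    (∫ s in (-1 : ℝ)..1, (jacobiM2 n).eval s * p.eval s) = 0 := by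
  have h := aux_orth (n - 2) (n - 4) (by omega) p
    (hp.trans_lt (by exact_mod_cast (by omega : n - 5 < n - 4)))
  have e : ∀ s : ℝ, (jacobiM2 n).eval s * p.eval s =
      ((-1 : ℝ) ^ n / (2 ^ (n - 4) * (n - 4).factorial)) *
      (p.eval s * (derivative^[n - 4] ((1 - X ^ 2 : ℝ[X]) ^ (n - 2))).eval s) := by
    intro s
    rw [jacobiM2, eval_mul, eval_C]
    ring
  simp_rw [e]
  rw [intervalIntegral.integral_const_mul, h, mul_zero]
end

section
/- For all integers m, n with 4 ≤ m < n, ∫_{−1}^{1} J_n^{−2,−2}(s) · J_m^{−2,−2}(s) · (1−s²)^{−2} ds = 0 (orthogonality of the generalized Jacobi polynomials with respect to the weight ω_{−2,−2}(s) = (1−s)^{−2}(1+s)^{−2}; note the integrand agrees almost everywhere on (−1,1) with a polynomial). -/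
open Polynomial

theorem aux_ibp (N k : ℕ) : ∀ q : Polynomial ℝ, k ≤ N → derivative^[k] q = 0 →
    ∫ s in (-1 : ℝ)..1, (derivative^[k] ((1 - X ^ 2 : ℝ[X]) ^ N)).eval s * q.eval s = 0 := by
  induction k with
  | zero =>
    intro q _ hq
    have : q = 0 := hq
    simp [this]
  | succ k ih =>
    intro q hk hq
    have h := ih (derivative q) (by omega) hq
    set f := derivative^[k] ((1 - X ^ 2 : ℝ[X]) ^ N) with hf
    obtain ⟨g, hg⟩ : (1 - X ^ 2 : ℝ[X]) ∣ f :=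
      (dvd_pow_self _ (by omega)).trans (pow_sub_dvd_iterate_derivative_pow (1 - X ^ 2 : ℝ[X]) N k)
    rw [Function.iterate_succ_apply', ← hf]
    have key := intervalIntegral.integral_mul_deriv_eq_deriv_mul (a := (-1 : ℝ)) (b := 1)
      (u := fun s => q.eval s) (v := fun s => f.eval s)
      (u' := fun s => (derivative q).eval s) (v' := fun s => (derivative f).eval s)
      (fun x _ => q.hasDerivAt x) (fun x _ => f.hasDerivAt x)
      ((derivative q).continuous.intervalIntegrable _ _)
      ((derivative f).continuous.intervalIntegrable _ _)
    have h1 : f.eval 1 = 0 := by rw [hg]; simp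
    have h2 : f.eval (-1) = 0 := by rw [hg]; simp
    simp only [h1, h2, mul_zero, sub_zero, zero_sub] at key
    simp only [mul_comm] at key h ⊢
    rw [key, h, neg_zero]

theorem stmt_10 (m n : ℕ) (hm : 4 ≤ m) (hmn : m < n) :
    (∫ s in (-1 : ℝ)..1,
        (jacobiM2 n).eval s * (jacobiM2 m).eval s * (1 - s ^ 2) ^ (-2 : ℤ)) = 0 := by
  obtain ⟨q, hq⟩ : (1 - X ^ 2 : ℝ[X]) ^ 2 ∣ derivative^[m - 4] ((1 - X ^ 2 : ℝ[X]) ^ (m - 2)) :=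
    (pow_dvd_pow _ (by omega)).trans
      (pow_sub_dvd_iterate_derivative_pow (1 - X ^ 2 : ℝ[X]) (m - 2) (m - 4))
  obtain ⟨g, hg⟩ : (1 - X ^ 2 : ℝ[X]) ∣ derivative^[n - 4] ((1 - X ^ 2 : ℝ[X]) ^ (n - 2)) :=
    (dvd_pow_self _ (by omega)).trans
      (pow_sub_dvd_iterate_derivative_pow (1 - X ^ 2 : ℝ[X]) (n - 2) (n - 4))
  have hd : (1 - X ^ 2 : ℝ[X]).natDegree = 2 := by compute_degree!
  have h0 : (1 - X ^ 2 : ℝ[X]) ≠ 0 := by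
    intro h; rw [h] at hd; simp at hd
  have hdeg : q.natDegree < n - 4 := by
    by_cases hq0 : q = 0
    · rw [hq0, natDegree_zero]; omega
    have h1 := natDegree_iterate_derivative ((1 - X ^ 2 : ℝ[X]) ^ (m - 2)) (m - 4)
    rw [hq, natDegree_mul (pow_ne_zero _ h0) hq0, natDegree_pow, natDegree_pow, hd] at h1
    omega
  have key := aux_ibp (n - 2) (n - 4) q (by omega) (iterate_derivative_eq_zero hdeg)
  unfold jacobiM2
  rw [hq]
  set f := derivative^[n - 4] ((1 - X ^ 2 : ℝ[X]) ^ (n - 2)) with hf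
  set a : ℝ := (-1 : ℝ) ^ n / (2 ^ (n - 4) * (n - 4).factorial)
  set b : ℝ := (-1 : ℝ) ^ m / (2 ^ (m - 4) * (m - 4).factorial)
  have e : ∀ s : ℝ, (C a * f).eval s * (C b * ((1 - X ^ 2) ^ 2 * q)).eval s
      * (1 - s ^ 2) ^ (-2 : ℤ) = (a * b) * (f.eval s * q.eval s) := by
    intro s
    by_cases hs : 1 - s ^ 2 = 0
    · have : f.eval s = 0 := by rw [hg]; simp [hs]
      simp [this]
    · simp only [eval_mul, eval_C, eval_pow, eval_sub, eval_one, eval_X]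
      rw [zpow_neg, show ((2 : ℤ)) = ((2 : ℕ) : ℤ) from rfl, zpow_natCast]
      field_simp
  simp only [e]
  rw [intervalIntegral.integral_const_mul, key, mul_zero]
end

section
/- For every integer n ≥ 3 and every s ∈ ℝ, J_{n+1}^{−2,−2}(s) = (4(n−1)(n−2)/(2n−1)) · (φ_{n+1}(s) − φ_{n−1}(s)). -/
open Polynomial

/-- The Legendre polynomial `L_n` given by Rodrigues' formula
`L_n = (1/(2^n n!)) · Dⁿ[(X² - 1)ⁿ]`. -/
noncomputable def legendreP (n : ℕ) : Polynomial ℝ :=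
  Polynomial.C (1 / (2 ^ n * n.factorial : ℝ)) *
    (Polynomial.derivative^[n] ((Polynomial.X ^ 2 - 1) ^ n))

/-- The Lobatto polynomial `φ_m` (for `m ≥ 1`), defined by
`φ_{n+1}(s) = ∫_{-1}^{s} L_n(t) dt`, i.e. `φ_m(s) = ∫_{-1}^{s} L_{m-1}(t) dt`. -/
noncomputable def lobatto (m : ℕ) (s : ℝ) : ℝ :=
  ∫ t in (-1 : ℝ)..s, (legendreP (m - 1)).eval t

lemma aux_d2 (m : ℕ) : derivative^[2] ((X ^ 2 - 1 : ℝ[X]) ^ (m + 2)) =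
    C (2 * (m + 2) * (2 * m + 3) : ℝ) * (X ^ 2 - 1) ^ (m + 1) +
      C (4 * (m + 2) * (m + 1) : ℝ) * (X ^ 2 - 1) ^ m := by
  simp only [Function.iterate_succ, Function.iterate_zero, Function.comp_apply, id]
  rw [derivative_pow_succ, derivative_mul, derivative_mul, derivative_pow_succ]
  simp
  simp only [map_ofNat]
  ring

lemma aux_leg (m : ℕ) : legendreP (m + 2) - legendreP m =
    C ((2 * m + 3) / (2 ^ (m + 1) * (m + 1).factorial) : ℝ) *
      derivative^[m] ((X ^ 2 - 1) ^ (m + 1)) := by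
  unfold legendreP
  rw [Function.iterate_add_apply, aux_d2, iterate_map_add, iterate_derivative_C_mul,
    iterate_derivative_C_mul, mul_add, ← mul_assoc, ← mul_assoc, ← C_mul, ← C_mul]
  have h1 : (1 / (2 ^ (m + 2) * (m + 2).factorial : ℝ)) * (2 * (m + 2) * (2 * m + 3)) =
      (2 * m + 3) / (2 ^ (m + 1) * (m + 1).factorial) := by
    have := Nat.factorial_ne_zero m
    rw [Nat.factorial_succ (m + 1)]
    push_cast
    field_simp
    ring
  have h2 : (1 / (2 ^ (m + 2) * (m + 2).factorial : ℝ)) * (4 * (m + 2) * (m + 1)) =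
      1 / (2 ^ m * m.factorial) := by
    rw [Nat.factorial_succ (m + 1), Nat.factorial_succ m]
    push_cast
    field_simp
    ring
  rw [h1, h2]
  ring

lemma aux_zero (k : ℕ) : (derivative^[k] ((X ^ 2 - 1 : ℝ[X]) ^ (k + 2))).eval (-1) = 0 := by
  have h : (X ^ 2 - 1 : ℝ[X]) ^ (k + 2 - k) ∣ derivative^[k] ((X ^ 2 - 1 : ℝ[X]) ^ (k + 2)) :=
    pow_sub_dvd_iterate_derivative_pow _ _ _
  obtain ⟨q, hq⟩ := h
  rw [hq]
  simp

theorem stmt_13 (n : ℕ) (hn : 3 ≤ n) (s : ℝ) :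
    (jacobiM2 (n + 1)).eval s =
      (4 * ((n : ℝ) - 1) * ((n : ℝ) - 2) / (2 * (n : ℝ) - 1)) *
        (lobatto (n + 1) s - lobatto (n - 1) s) := by
  obtain ⟨k, rfl⟩ := Nat.exists_eq_add_of_le' hn
  have hJ : jacobiM2 (k + 3 + 1) = C (1 / (2 ^ k * k.factorial) : ℝ) *
      derivative^[k] ((X ^ 2 - 1) ^ (k + 2)) := by
    unfold jacobiM2
    have e : (1 - X ^ 2 : ℝ[X]) ^ (k + 2) = C ((-1) ^ k) * (X ^ 2 - 1) ^ (k + 2) := by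
      rw [← neg_sub, neg_pow]
      simp [pow_succ]
    rw [show k + 3 + 1 - 4 = k by omega, show k + 3 + 1 - 2 = k + 2 by omega, e,
      iterate_derivative_C_mul, ← mul_assoc, ← C_mul]
    congr 2
    rw [div_mul_eq_mul_div, ← pow_add, Even.neg_one_pow ⟨k + 2, by ring⟩]
  set P : ℝ[X] := C ((2 * k + 5) / (2 ^ (k + 2) * (k + 2).factorial) : ℝ) *
      derivative^[k] ((X ^ 2 - 1) ^ (k + 2)) with hP
  have hd : derivative P = legendreP (k + 3) - legendreP (k + 1) := by
    rw [aux_leg (k + 1), hP, derivative_C_mul, Function.iterate_succ_apply']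
    congr 3
    push_cast
    ring
  have hL : lobatto (k + 3 + 1) s - lobatto (k + 3 - 1) s = P.eval s := by
    unfold lobatto
    rw [show k + 3 + 1 - 1 = k + 3 by omega, show k + 3 - 1 - 1 = k + 1 by omega,
      ← intervalIntegral.integral_sub ((Polynomial.continuous _).intervalIntegrable _ _)
        ((Polynomial.continuous _).intervalIntegrable _ _)]
    simp_rw [← eval_sub, ← hd]
    rw [intervalIntegral.integral_eq_sub_of_hasDerivAt (fun x _ => P.hasDerivAt x)
      ((Polynomial.continuous _).intervalIntegrable _ _)]
    rw [hP, eval_mul (x := -1), aux_zero]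
    simp
  rw [hL, hJ, hP, eval_mul, eval_mul, eval_C, eval_C, ← mul_assoc]
  congr 1
  rw [Nat.factorial_succ (k + 1), Nat.factorial_succ k]
  push_cast
  rw [show (2 * ((k : ℝ) + 3) - 1) = 2 * k + 5 by ring]
  have h5 : (2 * (k : ℝ) + 5) ≠ 0 := by positivity
  have := Nat.factorial_ne_zero k
  field_simp
  ring
end

section
/- Let c < d be reals, N ≥ 1 and k ≥ 2 integers, c = y_0 < y_1 < ⋯ < y_N = d a partition, and (P_1, …, P_N) a C¹ piecewise polynomial with zero boundary values such that each P_j has degree at most k. If for every 1 ≤ j ≤ N and every polynomial θ ∈ ℝ[X] of degree at most k−2 one has ∫_{y_{j−1}}^{y_j} P_j(t)·θ(t) dt = 0, then P_j = 0 for every j. -/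
open Polynomial

/-- `(P 1, …, P N)` is a C¹ piecewise polynomial with zero boundary values for the
partition `y 0 < y 1 < ⋯ < y N`: the pieces match in value and first derivative at the
interior nodes, and the boundary values at `y 0` and `y N` vanish. -/
def IsC1PiecewiseZeroBdry (N : ℕ) (y : ℕ → ℝ) (P : ℕ → Polynomial ℝ) : Prop :=
  (∀ j, 1 ≤ j → j ≤ N - 1 →
      (P j).eval (y j) = (P (j + 1)).eval (y j) ∧
      (Polynomial.derivative (P j)).eval (y j) =
        (Polynomial.derivative (P (j + 1))).eval (y j)) ∧
  (P 1).eval (y 0) = 0 ∧ (P N).eval (y N) = 0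

theorem aux_energy (p : Polynomial ℝ) (a b : ℝ)
    (h : (∫ t in a..b, p.eval t * (derivative (derivative p)).eval t) = 0) :
    (∫ t in a..b, ((derivative p).eval t) ^ 2) =
      (p * derivative p).eval b - (p * derivative p).eval a := by
  have h1 : (∫ t in a..b, (derivative (p * derivative p)).eval t) =
      (p * derivative p).eval b - (p * derivative p).eval a := by
    apply intervalIntegral.integral_eq_sub_of_hasDerivAt
    · intro x _
      exact Polynomial.hasDerivAt _ x
    · exact (Polynomial.continuous _).intervalIntegrable _ _
  rw [← h1, ← add_zero (∫ t in a..b, ((derivative p).eval t) ^ 2), ← h,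
    ← intervalIntegral.integral_add]
  · congr 1
    ext t
    simp [Polynomial.derivative_mul]
    ring
  · exact ((Polynomial.continuous _).pow 2).intervalIntegrable _ _
  · exact ((Polynomial.continuous _).mul (Polynomial.continuous _)).intervalIntegrable _ _

theorem aux_zero_s18 (q : Polynomial ℝ) (a b : ℝ) (hab : a < b)
    (h : (∫ t in a..b, (q.eval t) ^ 2) = 0) : q = 0 := by
  by_contra hq
  have : ∃ c ∈ Set.Icc a b, q.eval c ≠ 0 := by
    by_contra hc
    push Not at hc
    exact hq (Polynomial.eq_zero_of_infinite_isRoot q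
      ((Set.Icc_infinite hab).mono (fun x hx => hc x hx)))
  obtain ⟨c, hc, hc0⟩ := this
  have := intervalIntegral.integral_pos (f := fun t => (q.eval t) ^ 2) hab
    ((Polynomial.continuous _).pow 2).continuousOn
    (fun x _ => sq_nonneg _) ⟨c, hc, by positivity⟩
  linarith

theorem stmt_18 (c d : ℝ) (hcd : c < d) (N k : ℕ) (hN : 1 ≤ N) (hk : 2 ≤ k)
    (y : ℕ → ℝ) (hy0 : y 0 = c) (hyN : y N = d)
    (hmono : ∀ j, j < N → y j < y (j + 1))
    (P : ℕ → Polynomial ℝ) (hP : IsC1PiecewiseZeroBdry N y P)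
    (hdeg : ∀ j, 1 ≤ j → j ≤ N → (P j).degree ≤ (k : WithBot ℕ))
    (hortho : ∀ j, 1 ≤ j → j ≤ N → ∀ θ : Polynomial ℝ,
      θ.degree ≤ ((k - 2 : ℕ) : WithBot ℕ) →
      (∫ t in (y (j - 1))..(y j), (P j).eval t * θ.eval t) = 0) :
    ∀ j, 1 ≤ j → j ≤ N → P j = 0 := by
  obtain ⟨hm, hb0, hbN⟩ := hP
  let G : ℕ → ℝ := fun j => if j = 0 then 0 else (P j * derivative (P j)).eval (y j)
  have hE : ∀ j, j < N → (∫ t in (y j)..(y (j + 1)), ((derivative (P (j + 1))).eval t) ^ 2) =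
      G (j + 1) - G j := by
    intro j hj
    have hdd : (derivative (derivative (P (j + 1)))).degree ≤ ((k - 2 : ℕ) : WithBot ℕ) := by
      have h0 := Polynomial.natDegree_le_of_degree_le (hdeg (j + 1) (by omega) (by omega))
      have h1 := Polynomial.natDegree_derivative_le (P (j + 1))
      have h2 := Polynomial.natDegree_derivative_le (derivative (P (j + 1)))
      exact Polynomial.degree_le_of_natDegree_le (by omega)
    rw [aux_energy _ (y j) _ (hortho (j + 1) (by omega) (by omega) _ hdd)]
    rcases Nat.eq_zero_or_pos j with rfl | hj0
    · simp [G, hb0]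
    · obtain ⟨e1, e2⟩ := hm j hj0 (by omega)
      simp [G, hj0.ne', e1, e2]
  have hsum : ∑ j ∈ Finset.range N, (G (j + 1) - G j) = 0 := by
    rw [Finset.sum_range_sub]
    simp [G, hbN]
  rw [Finset.sum_eq_zero_iff_of_nonneg] at hsum
  swap
  · intro j hj
    have hj := Finset.mem_range.1 hj
    rw [← hE j hj]
    exact intervalIntegral.integral_nonneg (hmono j hj).le (fun _ _ => sq_nonneg _)
  have hD : ∀ j, j < N → derivative (P (j + 1)) = 0 := fun j hj =>
    aux_zero_s18 _ _ _ (hmono j hj) ((hE j hj).trans (hsum j (Finset.mem_range.2 hj)))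
  have key : ∀ j, j < N → (P (j + 1)).eval (y j) = 0 → P (j + 1) = 0 := by
    intro j hj h
    have hc := Polynomial.eq_C_of_natDegree_eq_zero
      (Polynomial.derivative_eq_zero.1 (hD j hj))
    rw [hc] at h ⊢
    simp at h
    simp [h]
  have main : ∀ j, j < N → P (j + 1) = 0 := by
    intro j
    induction j with
    | zero => exact fun h => key 0 h hb0
    | succ n ih =>
      intro h
      apply key _ h
      rw [← (hm (n + 1) (by omega) (by omega)).1, ih (by omega)]
      simp
  intro j h1 h2
  obtain ⟨i, rfl⟩ : ∃ i, j = i + 1 := ⟨j - 1, by omega⟩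
  exact main i (by omega)
end

section
/- Let c < d be reals, N ≥ 1 and k ≥ 2 integers, c = y_0 < y_1 < ⋯ < y_N = d a partition, and g : ℝ → ℝ a function continuous on [c,d]. Then there exists exactly one C¹ piecewise polynomial with zero boundary values (P_1, …, P_N) such that each P_j has degree at most k and, for every 1 ≤ j ≤ N and every polynomial θ ∈ ℝ[X] of degree at most k−2, ∫_{y_{j−1}}^{y_j} P_j(t)·θ(t) dt = ∫_{y_{j−1}}^{y_j} g(t)·θ(t) dt. -/
open Polynomial

/-- integral of `p * θ` as a linear map in `p` -/
noncomputable def momLin (a b : ℝ) (θ : Polynomial ℝ) : Polynomial ℝ →ₗ[ℝ] ℝ where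
  toFun p := ∫ t in a..b, p.eval t * θ.eval t
  map_add' p q := by
    simp only [eval_add, add_mul]
    exact intervalIntegral.integral_add
      (Continuous.intervalIntegrable (p.continuous.mul θ.continuous) _ _)
      (Continuous.intervalIntegrable (q.continuous.mul θ.continuous) _ _)
  map_smul' r p := by
    simp only [eval_smul, smul_eq_mul, mul_assoc, RingHom.id_apply]
    exact intervalIntegral.integral_const_mul _ _

theorem mom_expand (a b : ℝ) (f : ℝ → ℝ) (hf : ContinuousOn f (Set.uIcc a b)) (n : ℕ)
    (θ : Polynomial ℝ) (hθ : θ.natDegree < n) :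
    (∫ t in a..b, f t * θ.eval t)
      = ∑ m ∈ Finset.range n, θ.coeff m * ∫ t in a..b, f t * t ^ m := by
  have h1 : ∀ t, f t * θ.eval t = ∑ m ∈ Finset.range n, θ.coeff m * (f t * t ^ m) := by
    intro t
    rw [eval_eq_sum_range' hθ, Finset.mul_sum]
    exact Finset.sum_congr rfl fun m _ => by ring
  simp only [h1]
  rw [intervalIntegral.integral_finsetSum]
  · exact Finset.sum_congr rfl fun m _ => intervalIntegral.integral_const_mul _ _
  · intro m _
    apply ContinuousOn.intervalIntegrable
    fun_prop

theorem energy_id (a b : ℝ) (p : Polynomial ℝ)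
    (h : (∫ t in a..b, p.eval t * (derivative (derivative p)).eval t) = 0) :
    (∫ t in a..b, (derivative p).eval t * (derivative p).eval t)
      = p.eval b * (derivative p).eval b - p.eval a * (derivative p).eval a := by
  have h2 : (∫ t in a..b, (derivative (p * derivative p)).eval t)
      = (p * derivative p).eval b - (p * derivative p).eval a :=
    intervalIntegral.integral_eq_sub_of_hasDerivAt (fun t _ => (p * derivative p).hasDerivAt t)
      (Continuous.intervalIntegrable (Polynomial.continuous _) _ _)
  simp only [derivative_mul, eval_add, eval_mul] at h2
  rw [intervalIntegral.integral_add
      (Continuous.intervalIntegrable (by fun_prop) _ _)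
      (Continuous.intervalIntegrable (by fun_prop) _ _), h, add_zero] at h2
  exact h2

theorem poly_zero_of_energy (a b : ℝ) (hab : a < b) (q : Polynomial ℝ)
    (h : (∫ t in a..b, q.eval t * q.eval t) = 0) : q = 0 := by
  apply Polynomial.eq_zero_of_infinite_isRoot
  apply (Set.Icc_infinite hab).mono
  intro x hx
  by_contra hne
  have : 0 < ∫ t in a..b, q.eval t * q.eval t :=
    intervalIntegral.integral_pos hab (by fun_prop) (fun t _ => mul_self_nonneg _)
      ⟨x, hx, mul_self_pos.2 hne⟩
  linarith

theorem uniq_zero (N k : ℕ) (hN : 1 ≤ N) (hk : 2 ≤ k) (y : ℕ → ℝ)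
    (hmono : ∀ j, j < N → y j < y (j + 1)) (Z : ℕ → Polynomial ℝ)
    (hC : IsC1PiecewiseZeroBdry N y Z)
    (hdeg : ∀ j, 1 ≤ j → j ≤ N → (Z j).natDegree ≤ k)
    (hm : ∀ j, 1 ≤ j → j ≤ N → ∀ θ : Polynomial ℝ, θ.natDegree ≤ k - 2 →
      (∫ t in (y (j - 1))..(y j), (Z j).eval t * θ.eval t) = 0) :
    ∀ j, 1 ≤ j → j ≤ N → Z j = 0 := by
  obtain ⟨hint, h0, hNb⟩ := hC
  set G : ℕ → ℝ := fun j => if j = 0 then 0 else (Z j).eval (y j) * (derivative (Z j)).eval (y j)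
    with hG
  have hE : ∀ j < N, (∫ t in (y j)..(y (j+1)), (derivative (Z (j+1))).eval t *
      (derivative (Z (j+1))).eval t) = G (j+1) - G j := by
    intro j hj
    have hh := hm (j+1) (by omega) (by omega) (derivative (derivative (Z (j+1)))) (by
      have h1 := natDegree_derivative_le (derivative (Z (j+1)))
      have h2 := natDegree_derivative_le (Z (j+1))
      have h3 := hdeg (j+1) (by omega) (by omega)
      omega)
    rw [Nat.add_sub_cancel] at hh
    rw [energy_id _ _ _ hh]
    rcases Nat.eq_zero_or_pos j with rfl | hp
    · simp [hG, h0]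
    · obtain ⟨e1, e2⟩ := hint j hp (by omega)
      simp [hG, hp.ne', e1, e2]
  have hsum : ∑ j ∈ Finset.range N, (∫ t in (y j)..(y (j+1)), (derivative (Z (j+1))).eval t *
      (derivative (Z (j+1))).eval t) = 0 := by
    rw [Finset.sum_congr rfl (fun j hj => hE j (Finset.mem_range.1 hj)), Finset.sum_range_sub]
    simp [hG, hNb]
  rw [Finset.sum_eq_zero_iff_of_nonneg] at hsum
  swap
  · intro j hj
    exact intervalIntegral.integral_nonneg (hmono j (Finset.mem_range.1 hj)).le
      (fun t _ => mul_self_nonneg _)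
  have hd : ∀ j < N, derivative (Z (j+1)) = 0 := fun j hj =>
    poly_zero_of_energy _ _ (hmono j hj) _ (hsum j (Finset.mem_range.2 hj))
  have hz : ∀ j < N, Z (j+1) = 0 := by
    intro j
    induction j with
    | zero =>
      intro hj
      have := eq_C_of_derivative_eq_zero (hd 0 hj)
      rw [this] at h0 ⊢
      simp only [eval_C] at h0
      simp at h0 ⊢
      exact h0
    | succ j ih =>
      intro hj
      have h1 := (hint (j+1) (by omega) (by omega)).1
      rw [ih (by omega)] at h1
      have := eq_C_of_derivative_eq_zero (hd (j+1) hj)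
      rw [this] at h1 ⊢
      simp at h1 ⊢
      exact h1.symm
  intro j h1 h2
  obtain ⟨i, rfl⟩ : ∃ i, j = i + 1 := ⟨j - 1, by omega⟩
  exact hz i (by omega)

/-- the `j`-th piece, extended by zero -/
noncomputable def extLin (N k : ℕ) (j : ℕ) :
    (Fin N → degreeLT ℝ (k+1)) →ₗ[ℝ] Polynomial ℝ :=
  if h : 1 ≤ j ∧ j ≤ N then
    (degreeLT ℝ (k+1)).subtype ∘ₗ LinearMap.proj (⟨j - 1, by omega⟩ : Fin N) else 0

theorem extLin_natDegree (N k j : ℕ) (v) : (extLin N k j v).natDegree ≤ k := by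
  unfold extLin
  split_ifs with h
  · have := (v (⟨j - 1, by omega⟩ : Fin N)).2
    rw [mem_degreeLT] at this
    rw [natDegree_le_iff_degree_le]
    rw [degree_le_iff_coeff_zero]
    rw [degree_lt_iff_coeff_zero] at this
    intro m hm
    exact this m (by exact_mod_cast hm)
  · simp

/-- evaluation of `p` at `x`, as a linear map -/
noncomputable def evLin (x : ℝ) : Polynomial ℝ →ₗ[ℝ] ℝ := Polynomial.leval x

/-- the whole linear system -/
noncomputable def sysLin (N k : ℕ) (y : ℕ → ℝ) :
    (Fin N → degreeLT ℝ (k+1)) →ₗ[ℝ]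
      (Fin N → Fin (k-1) → ℝ) × (Fin N → ℝ) × (Fin N → ℝ) :=
  LinearMap.prod
    (LinearMap.pi fun i => LinearMap.pi fun m =>
      momLin (y i) (y (i+1)) (X ^ (m : ℕ)) ∘ₗ extLin N k (i+1))
    (LinearMap.prod
      (LinearMap.pi fun i => evLin (y (i+1)) ∘ₗ (extLin N k (i+1) - extLin N k (i+2)))
      (LinearMap.pi fun i =>
        if (i : ℕ) = 0 then evLin (y 0) ∘ₗ extLin N k 1
        else evLin (y i) ∘ₗ derivative ∘ₗ (extLin N k i - extLin N k (i+1))))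

theorem sys_sol (N k : ℕ) (hN : 1 ≤ N) (y : ℕ → ℝ) (v) (μ : Fin N → Fin (k-1) → ℝ)
    (h : sysLin N k y v = (μ, 0, 0)) :
    IsC1PiecewiseZeroBdry N y (fun j => extLin N k j v) ∧
    ∀ (i : Fin N) (m : Fin (k-1)),
      (∫ t in (y i)..(y (i+1)), (extLin N k (i+1) v).eval t * t ^ (m : ℕ)) = μ i m := by
  have h1 := congrArg (fun w => w.1) h
  have h2 := congrArg (fun w => w.2.1) h
  have h3 := congrArg (fun w => w.2.2) h
  simp only [sysLin, LinearMap.prod_apply, Function.prod] at h1 h2 h3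
  refine ⟨⟨?_, ?_, ?_⟩, ?_⟩
  · intro j hj hj'
    have a := congrFun h2 (⟨j-1, by omega⟩ : Fin N)
    have b := congrFun h3 (⟨j, by omega⟩ : Fin N)
    obtain ⟨i, rfl⟩ : ∃ i, j = i + 1 := ⟨j - 1, by omega⟩
    simp [evLin, sub_eq_zero] at a b
    exact ⟨a, b⟩
  · have b := congrFun h3 (⟨0, by omega⟩ : Fin N)
    simpa [evLin] using b
  · have a := congrFun h2 (⟨N-1, by omega⟩ : Fin N)
    obtain ⟨i, rfl⟩ : ∃ i, N = i + 1 := ⟨N - 1, by omega⟩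
    have e : extLin (i+1) k (i+2) = 0 := by
      unfold extLin
      rw [dif_neg (by omega)]
    simpa [evLin, e] using a
  · intro i m
    have := congrFun (congrFun h1 i) m
    simpa [momLin] using this

theorem sys_inj (N k : ℕ) (hN : 1 ≤ N) (hk : 2 ≤ k) (y : ℕ → ℝ)
    (hmono : ∀ j, j < N → y j < y (j + 1)) : Function.Injective (sysLin N k y) := by
  rw [← LinearMap.ker_eq_bot, LinearMap.ker_eq_bot']
  intro v hv
  obtain ⟨hC, hM⟩ := sys_sol N k hN y v 0 hv
  have := uniq_zero N k hN hk y hmono _ hC (fun j _ _ => extLin_natDegree N k j v) (by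
    intro j hj hj' θ hθ
    obtain ⟨i, rfl⟩ : ∃ i, j = i + 1 := ⟨j - 1, by omega⟩
    rw [Nat.add_sub_cancel,
      mom_expand _ _ _ (by fun_prop) (k-1) θ (by omega)]
    apply Finset.sum_eq_zero
    intro m hm
    have := hM ⟨i, by omega⟩ ⟨m, Finset.mem_range.1 hm⟩
    simp only at this
    rw [this]; simp)
  funext i
  have h := this (i+1) (by omega) (by omega)
  simp only [extLin] at h
  rw [dif_pos ⟨by omega, by omega⟩] at h
  simpa using h

theorem sys_surj (N k : ℕ) (hN : 1 ≤ N) (hk : 2 ≤ k) (y : ℕ → ℝ)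
    (hmono : ∀ j, j < N → y j < y (j + 1)) : Function.Surjective (sysLin N k y) := by
  have : Module.Finite ℝ (degreeLT ℝ (k+1)) :=
    Module.Finite.equiv (degreeLTEquiv ℝ (k+1)).symm
  have hr : Module.finrank ℝ (degreeLT ℝ (k+1)) = k + 1 := by
    rw [(degreeLTEquiv ℝ (k+1)).finrank_eq]; simp
  refine (LinearMap.injective_iff_surjective_of_finrank_eq_finrank ?_).1
    (sys_inj N k hN hk y hmono)
  simp only [Module.finrank_prod, Module.finrank_pi_fintype, hr, Module.finrank_self,
    Finset.sum_const, Finset.card_univ, Fintype.card_fin, smul_eq_mul, mul_one]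
  obtain ⟨l, rfl⟩ : ∃ l, k = l + 2 := ⟨k - 2, by omega⟩
  simp only [show l + 2 - 1 = l + 1 by omega]
  ring

theorem stmt_19 (c d : ℝ) (hcd : c < d) (N k : ℕ) (hN : 1 ≤ N) (hk : 2 ≤ k)
    (y : ℕ → ℝ) (hy0 : y 0 = c) (hyN : y N = d)
    (hmono : ∀ j, j < N → y j < y (j + 1))
    (g : ℝ → ℝ) (hg : ContinuousOn g (Set.Icc c d)) :
    ∃ P : ℕ → Polynomial ℝ,
      (IsC1PiecewiseZeroBdry N y P ∧
        (∀ j, 1 ≤ j → j ≤ N → (P j).degree ≤ (k : WithBot ℕ)) ∧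
        (∀ j, 1 ≤ j → j ≤ N → ∀ θ : Polynomial ℝ,
          θ.degree ≤ ((k - 2 : ℕ) : WithBot ℕ) →
          (∫ t in (y (j - 1))..(y j), (P j).eval t * θ.eval t) =
            ∫ t in (y (j - 1))..(y j), g t * θ.eval t)) ∧
      ∀ Q : ℕ → Polynomial ℝ,
        (IsC1PiecewiseZeroBdry N y Q ∧
          (∀ j, 1 ≤ j → j ≤ N → (Q j).degree ≤ (k : WithBot ℕ)) ∧
          (∀ j, 1 ≤ j → j ≤ N → ∀ θ : Polynomial ℝ,
            θ.degree ≤ ((k - 2 : ℕ) : WithBot ℕ) →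
            (∫ t in (y (j - 1))..(y j), (Q j).eval t * θ.eval t) =
              ∫ t in (y (j - 1))..(y j), g t * θ.eval t)) →
        ∀ j, 1 ≤ j → j ≤ N → Q j = P j := by
  have hym : ∀ n, n ≤ N → ∀ m, m ≤ n → y m ≤ y n := by
    intro n
    induction n with
    | zero => intro _ m hm; rw [Nat.le_zero.1 hm]
    | succ n ih =>
      intro hn m hm
      rcases Nat.lt_or_ge m (n+1) with h | h
      · exact (ih (by omega) m (by omega)).trans (hmono n (by omega)).le
      · rw [le_antisymm hm h]
  have hgc : ∀ i < N, ContinuousOn g (Set.uIcc (y i) (y (i+1))) := by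
    intro i hi
    apply hg.mono
    rw [Set.uIcc_of_le (hmono i hi).le]
    apply Set.Icc_subset_Icc
    · rw [← hy0]; exact hym i (by omega) 0 (by omega)
    · rw [← hyN]; exact hym N le_rfl (i+1) (by omega)
  obtain ⟨v, hv⟩ := sys_surj N k hN hk y hmono
    ((fun i m => ∫ t in (y i)..(y (i+1)), g t * t ^ (m : ℕ)), 0, 0)
  obtain ⟨hC, hM⟩ := sys_sol N k hN y v _ hv
  have hP : ∀ j, 1 ≤ j → j ≤ N → ∀ θ : Polynomial ℝ,
          θ.degree ≤ ((k - 2 : ℕ) : WithBot ℕ) →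
          (∫ t in (y (j - 1))..(y j), (extLin N k j v).eval t * θ.eval t) =
            ∫ t in (y (j - 1))..(y j), g t * θ.eval t := by
    intro j hj hj' θ hθ
    rw [← natDegree_le_iff_degree_le] at hθ
    obtain ⟨i, rfl⟩ : ∃ i, j = i + 1 := ⟨j - 1, by omega⟩
    rw [Nat.add_sub_cancel,
      mom_expand _ _ _ (by fun_prop) (k-1) θ (by omega),
      mom_expand _ _ g (hgc i (by omega)) (k-1) θ (by omega)]
    apply Finset.sum_congr rfl
    intro m hm
    have := hM ⟨i, by omega⟩ ⟨m, Finset.mem_range.1 hm⟩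
    simp only at this
    rw [this]
  refine ⟨fun j => extLin N k j v, ⟨hC, ?_, hP⟩, ?_⟩
  · intro j _ _
    exact natDegree_le_iff_degree_le.1 (extLin_natDegree N k j v)
  · rintro Q ⟨hQC, hQd, hQm⟩ j hj hj'
    refine sub_eq_zero.1 (uniq_zero N k hN hk y hmono (fun j => Q j - extLin N k j v)
      ⟨?_, ?_, ?_⟩ ?_ ?_ j hj hj')
    · intro j h1 h2
      obtain ⟨a, b⟩ := hQC.1 j h1 h2
      obtain ⟨a', b'⟩ := hC.1 j h1 h2
      simp only at a' b'
      simp [a, b, a', b']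
    · have a := hQC.2.1
      have b := hC.2.1
      simp only at b
      simp [a, b]
    · have a := hQC.2.2
      have b := hC.2.2
      simp only at b
      simp [a, b]
    · intro j h1 h2
      exact (natDegree_sub_le _ _).trans (max_le
        (natDegree_le_iff_degree_le.2 (hQd j h1 h2)) (extLin_natDegree N k j v))
    · intro j h1 h2 θ hθ
      rw [natDegree_le_iff_degree_le] at hθ
      have e := (momLin (y (j-1)) (y j) θ).map_sub (Q j) (extLin N k j v)
      simp only [momLin, LinearMap.coe_mk, AddHom.coe_mk] at e
      rw [e, hQm j h1 h2 θ hθ, hP j h1 h2 θ hθ, sub_self]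
end
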